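/- Let Γ = (V,E) be a finite simple graph, K a field, and x : V → K. Let U = supp(x) = {v ∈ V : x_v ≠ 0}. Then the dimension over K of the specialised adjacency module Adj(Γ)ₓ equals c_Γ(U) + |V| − |N_Γ[U]|. -/

import Mathlib

/-- The submodule of relations `x_v • e_w - x_w • e_v` over all adjacent pairs `v ~ w`. -/
def adjRelations {V : Type*} {K : Type*} [Field K] [DecidableEq V]
    (G : SimpleGraph V) (x : V → K) : Submodule K (V → K) :=
  Submodule.span K
    {y | ∃ v w, G.Adj v w ∧ y = x v • (Pi.single w 1 : V → K) - x w • (Pi.single v 1 : V → K)}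

/-- The specialised adjacency module `Adj(Γ)ₓ`: the quotient of `K^V`
by the relations `x_v • e_w - x_w • e_v` for adjacent `v ~ w`. -/
abbrev AdjMod {V : Type*} {K : Type*} [Field K] [DecidableEq V]
    (G : SimpleGraph V) (x : V → K) :=
  (V → K) ⧸ adjRelations G x

/-- The functions `f` with `x v * f w = x w * f v` along every edge `v ~ w`. -/
def edgeProportional {V K : Type*} [Field K] (G : SimpleGraph V) (x : V → K) :
    Submodule K (V → K) where
  carrier := {f | ∀ v w, G.Adj v w → x v * f w = x w * f v}
  zero_mem' := by simp
  add_mem' hf hg v w h := by simp [mul_add, hf v w h, hg v w h]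
  smul_mem' c f hf v w h := by
    simp only [Pi.smul_apply, smul_eq_mul, mul_left_comm _ c, hf v w h]

/-- Restricting functionals on `AdjMod G x` to the images of the standard basis. -/
def dualAdjModEval {V K : Type*} [Field K] [DecidableEq V] (G : SimpleGraph V) (x : V → K) :
    Module.Dual K (AdjMod G x) →ₗ[K] V → K where
  toFun φ v := φ (Submodule.Quotient.mk (Pi.single v 1))
  map_add' _ _ := rfl
  map_smul' _ _ := rfl

theorem dualAdjModEval_injective {V K : Type*} [Field K] [Finite V] [DecidableEq V]
    (G : SimpleGraph V) (x : V → K) : Function.Injective (dualAdjModEval G x) := by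
  intro φ ψ h
  apply Submodule.linearMap_qext
  refine (Pi.basisFun K V).ext fun v => ?_
  simpa [dualAdjModEval] using congrFun h v

theorem range_dualAdjModEval {V K : Type*} [Field K] [Fintype V] [DecidableEq V]
    (G : SimpleGraph V) (x : V → K) :
    LinearMap.range (dualAdjModEval G x) = edgeProportional G x := by
  apply le_antisymm
  · rintro _ ⟨φ, rfl⟩ v w h
    have hmem : x v • (Pi.single w 1 : V → K) - x w • (Pi.single v 1 : V → K) ∈
        adjRelations G x := Submodule.subset_span ⟨v, w, h, rfl⟩
    have hzero := congrArg φ ((Submodule.Quotient.mk_eq_zero _).mpr hmem)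
    simpa [sub_eq_zero, dualAdjModEval] using hzero
  · intro f hf
    let ψ : (V → K) →ₗ[K] K := (Pi.basisFun K V).constr K f
    have hψ (v : V) : ψ (Pi.single v 1) = f v := by
      simpa only [Pi.basisFun_apply] using (Pi.basisFun K V).constr_basis K f v
    have hle : adjRelations G x ≤ LinearMap.ker ψ := by
      refine Submodule.span_le.mpr ?_
      rintro _ ⟨v, w, h, rfl⟩
      simpa [hψ, sub_eq_zero] using hf v w h
    exact ⟨(adjRelations G x).liftQ ψ hle, funext hψ⟩

open Classical in
/-- The function which is a multiple of `x` on each component of the graph induced on `U`,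
vanishes on the remaining neighbours of `U`, and is prescribed elsewhere. -/
noncomputable def ofComponents {V K : Type*} [Field K]
    (G : SimpleGraph V) (x : V → K) (U : Finset V) :
    ((G.induce (↑U : Set V)).ConnectedComponent → K) ×
      ({v : V // ¬ (v ∈ U ∨ ∃ u ∈ U, G.Adj u v)} → K) →ₗ[K] V → K where
  toFun p v :=
    if h : v ∈ U then
      x v * p.1 ((G.induce (↑U : Set V)).connectedComponentMk ⟨v, h⟩)
    else if h' : v ∈ U ∨ ∃ u ∈ U, G.Adj u v then 0 else p.2 ⟨v, h'⟩
  map_add' p q := by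
    ext v
    simp only [Pi.add_apply, Prod.fst_add, Prod.snd_add]
    split_ifs <;> simp [mul_add]
  map_smul' c p := by
    ext v
    simp only [Pi.smul_apply, Prod.smul_fst, Prod.smul_snd, RingHom.id_apply]
    split_ifs <;> simp [mul_left_comm]

section

variable {V K : Type*} [Field K] {G : SimpleGraph V} {x : V → K} {U : Finset V}

theorem ofComponents_of_mem
    (p : ((G.induce (↑U : Set V)).ConnectedComponent → K) ×
      ({v : V // ¬ (v ∈ U ∨ ∃ u ∈ U, G.Adj u v)} → K)) {v : V} (h : v ∈ U) :
    ofComponents G x U p v =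
      x v * p.1 ((G.induce (↑U : Set V)).connectedComponentMk ⟨v, h⟩) :=
  dif_pos h

theorem ofComponents_of_adj
    (p : ((G.induce (↑U : Set V)).ConnectedComponent → K) ×
      ({v : V // ¬ (v ∈ U ∨ ∃ u ∈ U, G.Adj u v)} → K)) {u v : V} (h : v ∉ U) (hu : u ∈ U)
    (huv : G.Adj u v) : ofComponents G x U p v = 0 :=
  (dif_neg h).trans (dif_pos (Or.inr ⟨u, hu, huv⟩))

theorem ofComponents_of_not_mem
    (p : ((G.induce (↑U : Set V)).ConnectedComponent → K) ×
      ({v : V // ¬ (v ∈ U ∨ ∃ u ∈ U, G.Adj u v)} → K)) {v : V}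
    (h : ¬ (v ∈ U ∨ ∃ u ∈ U, G.Adj u v)) :
    ofComponents G x U p v = p.2 ⟨v, h⟩ :=
  (dif_neg fun hv => h (Or.inl hv)).trans (dif_neg h)

theorem ofComponents_injective (hU : ∀ v, v ∈ U ↔ x v ≠ 0) :
    Function.Injective (ofComponents G x U) := by
  intro p q h
  refine Prod.ext (funext fun c => ?_) (funext fun ⟨v, hv⟩ => ?_)
  · induction c using SimpleGraph.ConnectedComponent.ind with
    | h v =>
      obtain ⟨v, hv⟩ := v
      have hv' : v ∈ U := hv
      have := congrFun h v
      rw [ofComponents_of_mem p hv', ofComponents_of_mem q hv'] at this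
      exact mul_left_cancel₀ ((hU v).mp hv') this
  · have := congrFun h v
    rwa [ofComponents_of_not_mem p hv, ofComponents_of_not_mem q hv] at this

theorem range_ofComponents (hU : ∀ v, v ∈ U ↔ x v ≠ 0) :
    LinearMap.range (ofComponents G x U) = edgeProportional G x := by
  have hx {v : V} (hv : v ∉ U) : x v = 0 := by simpa [hU] using hv
  apply le_antisymm
  · rintro _ ⟨p, rfl⟩ v w h
    by_cases hv : v ∈ U <;> by_cases hw : w ∈ U
    · rw [ofComponents_of_mem p hv, ofComponents_of_mem p hw,
        SimpleGraph.ConnectedComponent.sound (G := G.induce (↑U : Set V))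
          (v := ⟨v, hv⟩) (w := ⟨w, hw⟩) (SimpleGraph.Adj.reachable h)]
      ring
    · rw [ofComponents_of_adj p hw hv h, hx hw, mul_zero, zero_mul]
    · rw [ofComponents_of_adj p hv hw h.symm, hx hv, mul_zero, zero_mul]
    · rw [hx hv, hx hw, zero_mul, zero_mul]
  · intro f hf
    have hratio (v w : (↑U : Set V)) (h : (G.induce (↑U : Set V)).Adj v w) :
        f v / x v = f w / x w := by
      rw [div_eq_div_iff ((hU v).mp v.2) ((hU w).mp w.2)]
      linear_combination -hf v w h
    have hwalk (v w : (↑U : Set V)) (p : (G.induce (↑U : Set V)).Walk v w) :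
        f v / x v = f w / x w := by
      induction p with
      | nil => rfl
      | cons h _ ih => exact (hratio _ _ h).trans ih
    refine ⟨⟨fun c => c.lift (fun v : (↑U : Set V) => f v / x v)
      fun v w p _ => hwalk v w p,
      fun v => f v⟩, funext fun v => ?_⟩
    by_cases hv : v ∈ U
    · rw [ofComponents_of_mem _ hv]
      exact mul_div_cancel₀ _ ((hU v).mp hv)
    · by_cases hv' : ∃ u ∈ U, G.Adj u v
      · obtain ⟨u, hu, huv⟩ := hv'
        rw [ofComponents_of_adj _ hv hu huv]
        have := hf u v huv
        rw [hx hv, zero_mul] at this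
        exact ((mul_eq_zero.mp this).resolve_left ((hU u).mp hu)).symm
      · rw [ofComponents_of_not_mem _ (not_or.mpr ⟨hv, hv'⟩)]

end

/-- `dim_K Adj(Γ)ₓ = c_Γ(U) + |V| - |N_Γ[U]|`, where `U = supp(x)`. -/
theorem finrank_adjMod {V : Type*} {K : Type*} [Field K] [Fintype V] [DecidableEq V]
    (G : SimpleGraph V) (x : V → K) (U : Finset V) (hU : ∀ v, v ∈ U ↔ x v ≠ 0) :
    Module.finrank K (AdjMod G x) =
      Nat.card (G.induce (↑U : Set V)).ConnectedComponent +
        (Fintype.card V - Nat.card {v : V // v ∈ U ∨ ∃ u ∈ U, G.Adj u v}) := by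
  classical
  rw [← Subspace.dual_finrank_eq,
    ← LinearMap.finrank_range_of_inj (dualAdjModEval_injective G x), range_dualAdjModEval,
    ← range_ofComponents hU, LinearMap.finrank_range_of_inj (ofComponents_injective hU)]
  have := Fintype.ofFinite (G.induce (↑U : Set V)).ConnectedComponent
  rw [Module.finrank_prod, Module.finrank_fintype_fun_eq_card, Module.finrank_fintype_fun_eq_card,
    Fintype.card_subtype_compl, Nat.card_eq_fintype_card, Nat.card_eq_fintype_card]
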